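/- Preliminary stability estimate (inequality (3.12) in the proof of Theorem 3.1): suppose u ∈ C²([0,T], H_u) and φ ∈ C¹([0,T], H_φ) satisfy, for every t ∈ [0,T], the momentum equation with datum f, the once-integrated mass equation with datum G, and the once-integrated momentum equation with datum F̂, where f : [0,T] → H_u is continuous and F̂ ∈ C¹([0,T], H_u), G ∈ C¹([0,T], H_φ) satisfy F̂' = f and G' = g with g : [0,T] → H_φ continuous. Assume there exist continuous N_f, N_F : [0,T] → ℝ≥0 and N_g, N_G : [0,T] → ℝ≥0 with |⟨f(t),v⟩| ≤ N_f(t)√(a_δ(v,v)), |⟨F̂(t),v⟩| ≤ N_F(t)√(a_δ(v,v)) for all v ∈ H_u, and |⟨g(t),ψ⟩| ≤ N_g(t)√(d(ψ,ψ)), |⟨G(t),ψ⟩| ≤ N_G(t)√(d(ψ,ψ)) for all ψ ∈ H_φ. Then there is an absolute constant C > 0, independent of the bilinear forms, of τ₁, τ₂, of T, and of the data, such that for all t ∈ [0,T]: τ₂² m_ρ(u'(t),u'(t)) + m_ρ(u(t),u(t)) + τ₂² a(u(t),u(t)) + a(W(t),W(t)) + τ₂τ₁ m₀(φ(t),φ(t))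 + m₀(Ψ(t),Ψ(t)) + ∫₀ᵗ a_δ(u,u) + ∫₀ᵗ τ₂² a_δ(u',u') + 2∫₀ᵗ τ₂ m₀(φ,φ) + 2τ₂ c(u(t),Ψ(t)) + 2∫₀ᵗ τ₁ m₀(φ',Ψ) ≤ C·[ I₀ + τ₂ N_G(t)² + ∫₀ᵗ ( τ₂² N_f² + τ₂² N_g² + N_F² + N_G² ) ], where I₀ = τ₂² m_ρ(u'(0),u'(0)) + m_ρ(u(0),u(0)) + τ₂² a(u(0),u(0)) + τ₂τ₁ m₀(φ(0),φ(0)). -/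

import Mathlib

open scoped RealInnerProductSpace

section BilinearForms

variable {E F : Type*} [NormedAddCommGroup E] [NormedSpace ℝ E]
  [NormedAddCommGroup F] [NormedSpace ℝ F]

theorem HasDerivAt.bilin {B : E →L[ℝ] F →L[ℝ] ℝ} {x : ℝ → E} {y : ℝ → F} {x' : E} {y' : F}
    {t : ℝ} (hx : HasDerivAt x x' t) (hy : HasDerivAt y y' t) :
    HasDerivAt (fun s => B (x s) (y s)) (B x' (y t) + B (x t) y') t :=
  (B.hasFDerivAt.comp_hasDerivAt t hx).clm_apply hy

theorem HasDerivAt.symm_bilin {B : E →L[ℝ] E →L[ℝ] ℝ} (hB : ∀ x y, B x y = B y x)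
    {x : ℝ → E} {x' : E} {t : ℝ} (hx : HasDerivAt x x' t) :
    HasDerivAt (fun s => B (x s) (x s)) (2 * B x' (x t)) t := by
  convert hx.bilin (B := B) hx using 1
  rw [hB (x t) x']
  ring

theorem ContinuousOn.bilin {B : E →L[ℝ] F →L[ℝ] ℝ} {x : ℝ → E} {y : ℝ → F} {S : Set ℝ}
    (hx : ContinuousOn x S) (hy : ContinuousOn y S) :
    ContinuousOn (fun s => B (x s) (y s)) S :=
  (B.continuous.comp_continuousOn hx).clm_apply hy

end BilinearForms

section Primitive

variable {E : Type*} [NormedAddCommGroup E] [NormedSpace ℝ E] {x : ℝ → E} {T : ℝ}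

theorem ContinuousOn.primitive_continuousOn (hT : 0 ≤ T) (hx : ContinuousOn x (Set.Icc 0 T)) :
    ContinuousOn (fun t => ∫ s in (0:ℝ)..t, x s) (Set.Icc 0 T) := by
  have h := intervalIntegral.continuousOn_primitive_interval (μ := MeasureTheory.volume)
    (a := 0) (b := T) (f := x)
    (by rw [Set.uIcc_of_le hT]; exact hx.integrableOn_Icc)
  rwa [Set.uIcc_of_le hT] at h

theorem ContinuousOn.hasDerivAt_primitive [CompleteSpace E] (hx : ContinuousOn x (Set.Icc 0 T))
    {t : ℝ} (ht : t ∈ Set.Ioo 0 T) :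
    HasDerivAt (fun t => ∫ s in (0:ℝ)..t, x s) (x t) t :=
  intervalIntegral.integral_hasDerivAt_right
    ((hx.mono (Set.Icc_subset_Icc_right ht.2.le)).intervalIntegrable_of_Icc ht.1.le)
    ((hx.mono Set.Ioo_subset_Icc_self).stronglyMeasurableAtFilter isOpen_Ioo t ht)
    (hx.continuousAt (Icc_mem_nhds ht.1 ht.2))

end Primitive

/-- Weighted Young inequality for a functional bounded by a seminorm `√q`. -/
theorem two_mul_le_of_abs_le_mul_sqrt {p N q : ℝ} (k : ℝ) (hq : 0 ≤ q)
    (h : |p| ≤ N * √q) : 2 * k * p ≤ k ^ 2 * N ^ 2 + q := by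
  have h₁ : k * p ≤ |k| * (N * √q) := calc
    k * p ≤ |k * p| := le_abs_self _
    _ = |k| * |p| := abs_mul k p
    _ ≤ |k| * (N * √q) := by gcongr
  nlinarith [sq_nonneg (|k| * N - √q), Real.sq_sqrt hq, sq_abs k]

/-- Preliminary stability estimate (inequality (3.12) in the proof of Theorem 3.1):
there is an absolute constant `C > 0`, independent of the Hilbert spaces, of the bilinear
forms, of `τ₁, τ₂`, of `T`, and of the data, controlling the stated energy quantities. -/
theorem preliminary_stability_estimate :
    ∃ C : ℝ, 0 < C ∧
      ∀ (Hu Hφ : Type)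
        (_ : NormedAddCommGroup Hu) (_ : InnerProductSpace ℝ Hu) (_ : CompleteSpace Hu)
        (_ : NormedAddCommGroup Hφ) (_ : InnerProductSpace ℝ Hφ) (_ : CompleteSpace Hφ)
        -- continuous symmetric positive-semidefinite bilinear forms
        (mρ a aδ : Hu →L[ℝ] Hu →L[ℝ] ℝ)
        (m₀ d : Hφ →L[ℝ] Hφ →L[ℝ] ℝ)
        (c : Hu →L[ℝ] Hφ →L[ℝ] ℝ),
        (∀ x y, mρ x y = mρ y x) → (∀ x, 0 ≤ mρ x x) →
        (∀ x y, a x y = a y x) → (∀ x, 0 ≤ a x x) →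
        (∀ x y, aδ x y = aδ y x) → (∀ x, 0 ≤ aδ x x) →
        (∀ x y, m₀ x y = m₀ y x) → (∀ x, 0 ≤ m₀ x x) →
        (∀ x y, d x y = d y x) → (∀ x, 0 ≤ d x x) →
        -- relaxation parameters and final time
        ∀ (τ₁ τ₂ : ℝ), 0 ≤ τ₁ → 0 ≤ τ₂ →
        ∀ (T : ℝ), 0 < T →
        -- u ∈ C²([0,T], Hu), φ ∈ C¹([0,T], Hφ)
        ∀ (u u' u'' : ℝ → Hu) (φ φ' : ℝ → Hφ),
        (∀ t ∈ Set.Icc (0:ℝ) T, HasDerivAt u (u' t) t) →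
        (∀ t ∈ Set.Icc (0:ℝ) T, HasDerivAt u' (u'' t) t) →
        ContinuousOn u'' (Set.Icc (0:ℝ) T) →
        (∀ t ∈ Set.Icc (0:ℝ) T, HasDerivAt φ (φ' t) t) →
        ContinuousOn φ' (Set.Icc (0:ℝ) T) →
        -- time primitives
        ∀ (Ψ : ℝ → Hφ), (∀ t, Ψ t = ∫ s in (0:ℝ)..t, φ s) →
        ∀ (W : ℝ → Hu), (∀ t, W t = ∫ s in (0:ℝ)..t, u s) →
        -- data: f, g continuous, Fhat' = f, G' = g
        ∀ (f Fhat : ℝ → Hu) (g G : ℝ → Hφ),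
        ContinuousOn f (Set.Icc (0:ℝ) T) →
        ContinuousOn g (Set.Icc (0:ℝ) T) →
        (∀ t ∈ Set.Icc (0:ℝ) T, HasDerivAt Fhat (f t) t) →
        (∀ t ∈ Set.Icc (0:ℝ) T, HasDerivAt G (g t) t) →
        -- weighted dual-norm bounds
        ∀ (Nf NF Ng NG : ℝ → ℝ),
        ContinuousOn Nf (Set.Icc (0:ℝ) T) → (∀ t ∈ Set.Icc (0:ℝ) T, 0 ≤ Nf t) →
        ContinuousOn NF (Set.Icc (0:ℝ) T) → (∀ t ∈ Set.Icc (0:ℝ) T, 0 ≤ NF t) →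
        ContinuousOn Ng (Set.Icc (0:ℝ) T) → (∀ t ∈ Set.Icc (0:ℝ) T, 0 ≤ Ng t) →
        ContinuousOn NG (Set.Icc (0:ℝ) T) → (∀ t ∈ Set.Icc (0:ℝ) T, 0 ≤ NG t) →
        (∀ t ∈ Set.Icc (0:ℝ) T, ∀ v : Hu, |⟪f t, v⟫| ≤ Nf t * Real.sqrt (aδ v v)) →
        (∀ t ∈ Set.Icc (0:ℝ) T, ∀ v : Hu, |⟪Fhat t, v⟫| ≤ NF t * Real.sqrt (aδ v v)) →
        (∀ t ∈ Set.Icc (0:ℝ) T, ∀ ψ : Hφ, |⟪g t, ψ⟫| ≤ Ng t * Real.sqrt (d ψ ψ)) →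
        (∀ t ∈ Set.Icc (0:ℝ) T, ∀ ψ : Hφ, |⟪G t, ψ⟫| ≤ NG t * Real.sqrt (d ψ ψ)) →
        -- momentum equation with datum f
        (∀ t ∈ Set.Icc (0:ℝ) T, ∀ v : Hu,
          mρ (u'' t) v + aδ (u' t) v + a (u t) v - c v (φ t) = ⟪f t, v⟫) →
        -- once-integrated mass equation with datum G
        (∀ t ∈ Set.Icc (0:ℝ) T, ∀ ψ : Hφ,
          τ₁ * m₀ (φ' t) ψ + τ₂ * c (u' t) ψ + m₀ (φ t) ψ + c (u t) ψ + d (Ψ t) ψ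
            = ⟪G t, ψ⟫) →
        -- once-integrated momentum equation with datum Fhat
        (∀ t ∈ Set.Icc (0:ℝ) T, ∀ v : Hu,
          mρ (u' t) v + aδ (u t) v + a (W t) v - c v (Ψ t) = ⟪Fhat t, v⟫) →
        -- preliminary stability estimate
        ∀ t ∈ Set.Icc (0:ℝ) T,
          τ₂ ^ 2 * mρ (u' t) (u' t) + mρ (u t) (u t)
            + τ₂ ^ 2 * a (u t) (u t) + a (W t) (W t)
            + τ₂ * τ₁ * m₀ (φ t) (φ t) + m₀ (Ψ t) (Ψ t)
            + (∫ s in (0:ℝ)..t, aδ (u s) (u s))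
            + (∫ s in (0:ℝ)..t, τ₂ ^ 2 * aδ (u' s) (u' s))
            + 2 * (∫ s in (0:ℝ)..t, τ₂ * m₀ (φ s) (φ s))
            + 2 * τ₂ * c (u t) (Ψ t)
            + 2 * (∫ s in (0:ℝ)..t, τ₁ * m₀ (φ' s) (Ψ s))
          ≤ C * ((τ₂ ^ 2 * mρ (u' 0) (u' 0) + mρ (u 0) (u 0)
              + τ₂ ^ 2 * a (u 0) (u 0) + τ₂ * τ₁ * m₀ (φ 0) (φ 0))
            + τ₂ * NG t ^ 2
            + ∫ s in (0:ℝ)..t,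
                (τ₂ ^ 2 * Nf s ^ 2 + τ₂ ^ 2 * Ng s ^ 2 + NF s ^ 2 + NG s ^ 2)) := by
  refine ⟨1, one_pos, ?_⟩
  intro Hu Hφ _ _ _ _ _ _ mρ a aδ m₀ d c hmρ _ ha _ _ haδ₀ hm₀ _ hd hd₀ τ₁ τ₂ _ hτ₂ T hT
    u u' u'' φ φ' hu hu' hu''c hφ hφ'c Ψ hΨ W hW f Fhat g G hfc hgc _ hG
    Nf NF Ng NG hNf _ hNF _ hNg _ hNG _ hf_le hF_le hg_le hG_le hmom hmass hmomI t ht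
  have huc : ContinuousOn u (Set.Icc 0 T) := HasDerivAt.continuousOn hu
  have hu'c : ContinuousOn u' (Set.Icc 0 T) := HasDerivAt.continuousOn hu'
  have hφc : ContinuousOn φ (Set.Icc 0 T) := HasDerivAt.continuousOn hφ
  have hGc : ContinuousOn G (Set.Icc 0 T) := HasDerivAt.continuousOn hG
  have hΨc : ContinuousOn Ψ (Set.Icc 0 T) := by
    rw [funext hΨ]; exact hφc.primitive_continuousOn hT.le
  have hWc : ContinuousOn W (Set.Icc 0 T) := by
    rw [funext hW]; exact huc.primitive_continuousOn hT.le
  have hΨd : ∀ s ∈ Set.Ioo 0 T, HasDerivAt Ψ (φ s) s := by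
    rw [funext hΨ]; exact fun s hs => hφc.hasDerivAt_primitive hs
  have hWd : ∀ s ∈ Set.Ioo 0 T, HasDerivAt W (u s) s := by
    rw [funext hW]; exact fun s hs => huc.hasDerivAt_primitive hs
  have hΨ₀ : Ψ 0 = 0 := by rw [hΨ, intervalIntegral.integral_same]
  have hW₀ : W 0 = 0 := by rw [hW, intervalIntegral.integral_same]
  have integrable {h : ℝ → ℝ} (hh : ContinuousOn h (Set.Icc 0 T)) :
      IntervalIntegrable h MeasureTheory.volume 0 t :=
    (hh.mono (Set.Icc_subset_Icc_right ht.2)).intervalIntegrable_of_Icc ht.1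
  -- the energy functional and its derivative
  let E : ℝ → ℝ := fun s => τ₂ ^ 2 * mρ (u' s) (u' s) + mρ (u s) (u s)
    + τ₂ ^ 2 * a (u s) (u s) + a (W s) (W s)
    + τ₂ * τ₁ * m₀ (φ s) (φ s) + m₀ (Ψ s) (Ψ s)
    + 2 * τ₂ * c (u s) (Ψ s) + τ₂ * d (Ψ s) (Ψ s) - 2 * τ₂ * ⟪G s, Ψ s⟫
  let E' : ℝ → ℝ := fun s => τ₂ ^ 2 * (2 * mρ (u'' s) (u' s)) + 2 * mρ (u' s) (u s)
    + τ₂ ^ 2 * (2 * a (u' s) (u s)) + 2 * a (u s) (W s)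
    + τ₂ * τ₁ * (2 * m₀ (φ' s) (φ s)) + 2 * m₀ (φ s) (Ψ s)
    + 2 * τ₂ * (c (u' s) (Ψ s) + c (u s) (φ s)) + τ₂ * (2 * d (φ s) (Ψ s))
    - 2 * τ₂ * (⟪G s, φ s⟫ + ⟪g s, Ψ s⟫)
  have hEc : ContinuousOn E (Set.Icc 0 T) :=
    (((((((((hu'c.bilin hu'c).const_mul _).add (huc.bilin huc)).add
      ((huc.bilin huc).const_mul _)).add (hWc.bilin hWc)).add
      ((hφc.bilin hφc).const_mul _)).add (hΨc.bilin hΨc)).add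
      ((huc.bilin hΨc).const_mul _)).add ((hΨc.bilin hΨc).const_mul _)).sub
      ((hGc.inner hΨc).const_mul _)
  have hE'c : ContinuousOn E' (Set.Icc 0 T) :=
    ((((((((((hu''c.bilin hu'c).const_mul _).const_mul _).add ((hu'c.bilin huc).const_mul _)).add
      (((hu'c.bilin huc).const_mul _).const_mul _)).add ((huc.bilin hWc).const_mul _)).add
      (((hφ'c.bilin hφc).const_mul _).const_mul _)).add ((hφc.bilin hΨc).const_mul _)).add
      (((hu'c.bilin hΨc).add (huc.bilin hφc)).const_mul _)).add
      (((hφc.bilin hΨc).const_mul _).const_mul _)).sub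
      (((hGc.inner hφc).add (hgc.inner hΨc)).const_mul _)
  have hEd : ∀ s ∈ Set.Ioo 0 T, HasDerivAt E (E' s) s := by
    intro s hs
    have hs' := Set.Ioo_subset_Icc_self hs
    exact (((((((((((hu' s hs').symm_bilin hmρ).const_mul _).add
      ((hu s hs').symm_bilin hmρ)).add
      (((hu s hs').symm_bilin ha).const_mul _)).add ((hWd s hs).symm_bilin ha)).add
      (((hφ s hs').symm_bilin hm₀).const_mul _)).add ((hΨd s hs).symm_bilin hm₀)).add
      (((hu s hs').bilin (hΨd s hs)).const_mul _)).add
      (((hΨd s hs).symm_bilin hd).const_mul _)).sub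
      (((hG s hs').inner ℝ (hΨd s hs)).const_mul _))
  have hFTC : ∫ s in (0:ℝ)..t, E' s = E t - E 0 :=
    intervalIntegral.integral_eq_sub_of_hasDerivAt_of_le ht.1
      (hEc.mono (Set.Icc_subset_Icc_right ht.2))
      (fun s hs => hEd s (Set.Ioo_subset_Ioo_right ht.2 hs)) (integrable hE'c)
  have hE₀ : E 0 = τ₂ ^ 2 * mρ (u' 0) (u' 0) + mρ (u 0) (u 0)
      + τ₂ ^ 2 * a (u 0) (u 0) + τ₂ * τ₁ * m₀ (φ 0) (φ 0) := by
    simp [E, hΨ₀, hW₀]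
  have i₁ := integrable (huc.bilin (B := aδ) huc)
  have i₂ := integrable ((hu'c.bilin (B := aδ) hu'c).const_mul (τ₂ ^ 2))
  have i₃ := integrable ((hφc.bilin (B := m₀) hφc).const_mul τ₂)
  have i₄ := integrable ((hφ'c.bilin (B := m₀) hΨc).const_mul τ₁)
  have hR : ContinuousOn
      (fun s => τ₂ ^ 2 * Nf s ^ 2 + τ₂ ^ 2 * Ng s ^ 2 + NF s ^ 2 + NG s ^ 2) (Set.Icc 0 T) :=
    ((((hNf.pow 2).const_mul _).add ((hNg.pow 2).const_mul _)).add (hNF.pow 2)).add (hNG.pow 2)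
  have hmono := intervalIntegral.integral_mono_on ht.1
    ((((((integrable hE'c).add i₁).add i₂).add (i₃.const_mul 2)).add (i₄.const_mul 2)))
    (integrable hR) <| by
      intro s hs
      have hs' := Set.Icc_subset_Icc_right ht.2 hs
      have e₁ := hmom s hs' (u' s)
      have e₂ := hmass s hs' (φ s)
      have e₃ := hmass s hs' (Ψ s)
      have e₄ := hmomI s hs' (u s)
      have y₁ := mul_le_mul_of_nonneg_left
        (two_mul_le_of_abs_le_mul_sqrt 1 (haδ₀ _) (hf_le s hs' (u' s))) (sq_nonneg τ₂)
      have y₂ := two_mul_le_of_abs_le_mul_sqrt 1 (haδ₀ _) (hF_le s hs' (u s))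
      have y₃ := two_mul_le_of_abs_le_mul_sqrt (-τ₂) (hd₀ _) (hg_le s hs' (Ψ s))
      have y₄ := two_mul_le_of_abs_le_mul_sqrt 1 (hd₀ _) (hG_le s hs' (Ψ s))
      have s₁ := ha (u s) (u' s)
      have s₂ := ha (u s) (W s)
      have s₃ := hd (φ s) (Ψ s)
      simp only [E']
      linear_combination y₁ + y₂ + y₃ + y₄ + 2 * τ₂ ^ 2 * e₁ + 2 * τ₂ * e₂ + 2 * e₃ + 2 * e₄
        - 2 * τ₂ ^ 2 * s₁ + 2 * s₂ + 2 * τ₂ * s₃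
  rw [intervalIntegral.integral_add ((((integrable hE'c).add i₁).add i₂).add (i₃.const_mul 2))
      (i₄.const_mul 2),
    intervalIntegral.integral_add (((integrable hE'c).add i₁).add i₂) (i₃.const_mul 2),
    intervalIntegral.integral_add ((integrable hE'c).add i₁) i₂,
    intervalIntegral.integral_add (integrable hE'c) i₁,
    intervalIntegral.integral_const_mul 2, intervalIntegral.integral_const_mul 2,
    hFTC, hE₀] at hmono
  have hGt := mul_le_mul_of_nonneg_left
    (two_mul_le_of_abs_le_mul_sqrt 1 (hd₀ _) (hG_le t ht (Ψ t))) hτ₂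
  simp only [E] at hmono
  linarith
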